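/- arXiv:1703.05434 — 6 statements merged into one kernel-verified Lean document; each statement's English description precedes it below -/
import Mathlib

section
/- Let N ≥ 1, let ω₁,…,ω_N be positive real numbers, and let x ∈ ℂ with Re x > 0. Then there exists an entire function F : ℂ → ℂ (differentiable on all of ℂ) such that F(s) = ζ_{E,N}(s,x;ω̄) for every s with Re s > N, and such that for every k ∈ ℕ, F(−k) = 2^{−N}·E_{N,k}(x;ω̄), where E_{N,k}(x;ω̄) is the higher-order Euler polynomial evaluated over A = ℂ. -/
noncomputable def twoUnit (A : Type*) [CommRing A] [Algebra ℚ A] : Aˣ where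
  val := 2
  inv := algebraMap ℚ A (1 / 2)
  val_inv := by
    rw [show (2 : A) = algebraMap ℚ A 2 from (map_ofNat (algebraMap ℚ A) 2).symm, ← map_mul]
    norm_num
  inv_val := by
    rw [show (2 : A) = algebraMap ℚ A 2 from (map_ofNat (algebraMap ℚ A) 2).symm, ← map_mul]
    norm_num

/-- Higher-order Euler polynomial `E_{N,n}(x; ω)`, defined via the generating-function
identity `∑_{n≥0} E_{N,n}(x;ω)·Tⁿ/n! = 2^N·exp(xT)·∏_{j=1}^N (exp(ωⱼT)+1)⁻¹` in `A⟦T⟧`,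
where each factor `exp(ωⱼT)+1` is invertible since its constant term is `2`. -/
noncomputable def eulerHO (A : Type*) [CommRing A] [Algebra ℚ A]
    (N : ℕ) (ω : Fin N → A) (x : A) (n : ℕ) : A :=
  (n.factorial : A) * PowerSeries.coeff n
    ((2 : A) ^ N • (PowerSeries.rescale x (PowerSeries.exp A) *
      ∏ j : Fin N,
        PowerSeries.invOfUnit (PowerSeries.rescale (ω j) (PowerSeries.exp A) + 1) (twoUnit A)))

/-- The multiple Barnes–Euler zeta function
`ζ_{E,N}(s,x;ω̄) = ∑_{t̄∈ℕ^N} (−1)^{t₁+⋯+t_N} (x+ω₁t₁+⋯+ω_Nt_N)^{−s}`,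
where `z^{−s} = exp(−s·Log z)` is the principal complex power. -/
noncomputable def zetaE (N : ℕ) (ω : Fin N → ℝ) (x s : ℂ) : ℂ :=
  ∑' t : Fin N → ℕ, (-1 : ℂ) ^ (∑ i, t i) * (x + ∑ i, (ω i : ℂ) * (t i : ℂ)) ^ (-s)

open MeasureTheory Set Filter Topology

def Dec (a : ℝ) (f : ℝ → ℂ) : Prop :=
  Continuous f ∧ ∃ C : ℝ, ∀ u : ℝ, 0 < u → ‖f u‖ ≤ C * Real.exp (-a * u)

lemma Dec.top {a : ℝ} {f : ℝ → ℂ} (h : Dec a f) : f =O[atTop] fun t => Real.exp (-a * t) := by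
  obtain ⟨hc, C, hC⟩ := h
  refine Asymptotics.IsBigO.of_bound C ?_
  filter_upwards [eventually_gt_atTop 0] with u hu
  rw [Real.norm_of_nonneg (Real.exp_pos _).le]
  exact hC u hu

lemma Dec.bot {a : ℝ} {f : ℝ → ℂ} (h : Dec a f) : f =O[𝓝[>] 0] (fun t : ℝ => t ^ (-(0:ℝ))) := by
  simp only [neg_zero, Real.rpow_zero]
  exact (h.1.continuousAt.tendsto.mono_left nhdsWithin_le_nhds).isBigO_one ℝ

lemma Dec.conv {a : ℝ} (ha : 0 < a) {f : ℝ → ℂ} (h : Dec a f) {s : ℂ} (hs : 0 < s.re) :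
    MellinConvergent f s :=
  mellinConvergent_of_isBigO_rpow_exp ha (h.1.locallyIntegrable.locallyIntegrableOn _) h.top h.bot hs

lemma Dec.diff {a : ℝ} (ha : 0 < a) {f : ℝ → ℂ} (h : Dec a f) {s : ℂ} (hs : 0 < s.re) :
    DifferentiableAt ℂ (mellin f) s :=
  mellin_differentiableAt_of_isBigO_rpow_exp ha
    (h.1.locallyIntegrable.locallyIntegrableOn _) h.top h.bot hs

lemma Dec.ibp {a : ℝ} (ha : 0 < a) {f f' : ℝ → ℂ} (h : Dec a f) (h' : Dec a f')
    (hd : ∀ u, HasDerivAt f (f' u) u) {s : ℂ} (hs : 0 < s.re) :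
    mellin f' (s + 1) = - s * mellin f s := by
  have hs0 : s ≠ 0 := by rintro rfl; simp at hs
  have c1 := h.conv ha hs
  have c2 := h'.conv ha (s := s + 1) (by simp; linarith)
  have := integral_Ioi_mul_deriv_eq_deriv_mul (a := 0) (u := fun t : ℝ => (t : ℂ) ^ s)
    (u' := fun t : ℝ => s * (t : ℂ) ^ (s - 1)) (v := f) (v' := f') (a' := 0) (b' := 0)
    ?_ (fun u _ => hd u) ?_ ?_ ?_ ?_
  · simp only [mellin, smul_eq_mul, add_sub_cancel_right]
    rw [this]
    simp only [mul_assoc, integral_const_mul]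
    ring
  · intro t ht
    exact hasDerivAt_ofReal_cpow_const (x := t) (ne_of_gt ht) hs0
  · simpa [MellinConvergent, Pi.mul_def] using c2
  · have := c1.const_mul s
    simp only [smul_eq_mul, ← mul_assoc] at this
    exact this
  · obtain ⟨hc, C, hC⟩ := h
    have h1 : Tendsto (fun t : ℝ => (t : ℂ) ^ s) (𝓝 0) (𝓝 0) := by
      have := (Complex.continuousAt_ofReal_cpow_const 0 s (Or.inl hs)).tendsto
      simpa [Complex.zero_cpow hs0] using this
    simpa [Pi.mul_def] using (h1.mul (hc.tendsto 0)).mono_left nhdsWithin_le_nhds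
  · obtain ⟨hc, C, hC⟩ := h
    have := (tendsto_rpow_mul_exp_neg_mul_atTop_nhds_zero s.re a ha).const_mul C
    rw [mul_zero] at this
    refine squeeze_zero_norm' ?_ this
    filter_upwards [eventually_gt_atTop 0] with u hu
    simp only [Pi.mul_apply, norm_mul]
    rw [Complex.norm_cpow_eq_rpow_re_of_pos hu]
    have := mul_le_mul_of_nonneg_left (hC u hu) (Real.rpow_nonneg hu.le s.re)
    linarith

lemma dec_exp {r : ℂ} {a : ℝ} (h : a ≤ r.re) : Dec a (fun u : ℝ => Complex.exp (-r * u)) := by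
  refine ⟨by fun_prop, 1, fun u hu => ?_⟩
  rw [Complex.norm_exp, one_mul]
  simp
  nlinarith

lemma mellin_exp_aux {r s : ℂ} (hr : 0 < r.re) (hs : 0 < s.re) :
    mellin (fun u : ℝ => Complex.exp (-r * u)) (s + 1)
      = s / r * mellin (fun u : ℝ => Complex.exp (-r * u)) s := by
  have hr0 : r ≠ 0 := by rintro rfl; simp at hr
  have h1 := dec_exp (le_refl r.re)
  have h2 : Dec r.re (fun u : ℝ => -r * Complex.exp (-r * u)) := by
    obtain ⟨hc, C, hC⟩ := h1
    refine ⟨by fun_prop, ‖r‖ * C, fun u hu => ?_⟩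
    rw [norm_mul, norm_neg, mul_assoc]
    exact mul_le_mul_of_nonneg_left (hC u hu) (norm_nonneg _)
  have := Dec.ibp hr h1 h2 (fun u => ?_) hs
  · have e : mellin (fun u : ℝ => -r * Complex.exp (-r * u)) (s + 1) =
      -r * mellin (fun u : ℝ => Complex.exp (-r * u)) (s + 1) := by
      exact mellin_const_smul (fun u : ℝ => Complex.exp (-r * u)) (s+1) (-r)
    rw [e] at this
    rw [div_mul_eq_mul_div, eq_div_iff hr0]
    linear_combination -this
  · have := ((hasDerivAt_id u).ofReal_comp.const_mul (-r)).cexp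
    simpa [mul_comm] using this

lemma mellin_exp_deriv {r s : ℂ} (hr : 0 < r.re) (hs : 0 < s.re) :
    HasDerivAt (fun r : ℂ => mellin (fun u : ℝ => Complex.exp (-r * u)) s)
      (-mellin (fun u : ℝ => Complex.exp (-r * u)) (s + 1)) r := by
  have hε : 0 < r.re / 2 := by linarith
  have hs1 : 0 < (s + 1).re := by simp; linarith
  have key : ∀ r' ∈ Metric.ball r (r.re / 2), r.re / 2 ≤ r'.re := by
    intro r' hr'
    have := (Complex.abs_re_le_norm (r' - r)).trans_lt (by simpa [dist_eq_norm] using hr')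
    rw [abs_lt] at this
    simp at this
    linarith
  have := hasDerivAt_integral_of_dominated_loc_of_deriv_le (μ := volume.restrict (Ioi (0:ℝ)))
    (F := fun (r : ℂ) (u : ℝ) => (u : ℂ) ^ (s - 1) • Complex.exp (-r * u))
    (F' := fun (r : ℂ) (u : ℝ) => -((u : ℂ) ^ (s + 1 - 1) • Complex.exp (-r * u)))
    (x₀ := r) (s := Metric.ball r (r.re/2))
    (bound := fun u : ℝ => ‖(u : ℂ) ^ (s + 1 - 1) • Complex.exp (-((r.re / 2 : ℝ) : ℂ) * u)‖)
    (Metric.ball_mem_nhds _ hε) ?_ ?_ ?_ ?_ ?_ ?_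
  · have h2 := this.2
    rw [integral_neg] at h2
    exact h2
  · filter_upwards [Metric.ball_mem_nhds r hε] with r' hr'
    exact ((dec_exp (key r' hr')).conv hε hs).aestronglyMeasurable
  · exact ((dec_exp le_rfl).conv hr hs)
  · exact ((dec_exp le_rfl).conv hr hs1).neg.aestronglyMeasurable
  · filter_upwards [ae_restrict_mem measurableSet_Ioi] with u hu r' hr'
    have := key r' hr'
    have hu' : 0 < u := hu
    rw [norm_neg, norm_smul, norm_smul]
    refine mul_le_mul_of_nonneg_left ?_ (norm_nonneg _)
    rw [Complex.norm_exp, Complex.norm_exp]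
    simp
    nlinarith
  · exact ((dec_exp (by simp)).conv hε hs1).norm
  · filter_upwards [ae_restrict_mem measurableSet_Ioi] with u hu r' hr'
    have hu' : (u : ℂ) ≠ 0 := by simpa using ne_of_gt (show 0 < u from hu)
    have := (((hasDerivAt_id r').neg.mul_const (u : ℂ)).cexp).const_mul ((u : ℂ) ^ (s - 1))
    convert! this using 1
    simp only [smul_eq_mul, id, Pi.neg_apply, add_sub_cancel_right, Complex.cpow_sub _ _ hu', Complex.cpow_one]
    field_simp

lemma mellin_exp {r s : ℂ} (hr : 0 < r.re) (hs : 0 < s.re) :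
    mellin (fun u : ℝ => Complex.exp (-r * u)) s = Complex.Gamma s * r ^ (-s) := by
  let U : Set ℂ := {r | 0 < r.re}
  have hU : IsOpen U := isOpen_lt continuous_const Complex.continuous_re
  have hUc : Convex ℝ U := convex_halfSpace_re_gt 0
  let φ : ℂ → ℂ := fun r => mellin (fun u : ℝ => Complex.exp (-r * u)) s * r ^ s
  have hφ : ∀ r ∈ U, HasDerivAt φ 0 r := by
    intro r hr
    have hr' : 0 < r.re := hr
    have hr0 : r ≠ 0 := by rintro rfl; simp at hr'
    have := (mellin_exp_deriv hr' hs).mul ((hasDerivAt_id r).cpow_const (c := s) (Or.inl hr'))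
    convert! this using 1
    rw [mellin_exp_aux hr' hs]
    simp only [id, Complex.cpow_sub _ _ hr0, Complex.cpow_one]
    field_simp
    ring
  have h1 : (1 : ℂ) ∈ U := by simp [U]
  have := hU.is_const_of_deriv_eq_zero hUc.isPreconnected
    (fun r hr => (hφ r hr).differentiableAt.differentiableWithinAt)
    (fun r hr => (hφ r hr).deriv) (show r ∈ U from hr) h1
  have hr0 : r ≠ 0 := by rintro rfl; simp at hr
  have hG : mellin (fun u : ℝ => Complex.exp (-1 * u)) s = Complex.Gamma s := by
    rw [Complex.Gamma_eq_integral hs, Complex.GammaIntegral_eq_mellin]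
    simp
  simp only [φ, Complex.one_cpow, mul_one, hG] at this
  rw [← this, Complex.cpow_neg, mul_assoc, mul_inv_cancel₀, mul_one]
  simp [Complex.cpow_eq_zero_iff, hr0]

lemma hasSum_pi_prod : ∀ (N : ℕ) (f : Fin N → ℕ → ℂ) (_ : ∀ i, Summable fun n => ‖f i n‖),
    (Summable fun t : Fin N → ℕ => ‖∏ i, f i (t i)‖) ∧
    HasSum (fun t : Fin N → ℕ => ∏ i, f i (t i)) (∏ i, ∑' n, f i n)
  | 0, f, h => by
    refine ⟨(hasSum_fintype _).summable, ?_⟩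
    have := hasSum_fintype (fun t : Fin 0 → ℕ => ∏ i, f i (t i))
    simpa using this
  | N + 1, f, h => by
    obtain ⟨h1, h2⟩ := hasSum_pi_prod N (fun i => f i.succ) (fun i => h _)
    have h3 := (h 0).mul_norm h1
    have h4 := ((h 0).of_norm).hasSum.mul h2 h3.of_norm
    rw [← (Fin.consEquiv (fun _ => ℕ)).summable_iff, ← (Fin.consEquiv (fun _ => ℕ)).hasSum_iff]
    simp only [Function.comp_def, Fin.prod_univ_succ]
    exact ⟨h3, h4⟩

/-! ### algebra -/

noncomputable def hfun (w : ℝ) (u : ℝ) : ℂ := (1 + Complex.exp (-(w : ℂ) * u))⁻¹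

lemma hfun_ne (w u : ℝ) : (1 + Complex.exp (-(w : ℂ) * u)) ≠ 0 := by
  have : (1 + Complex.exp (-(w : ℂ) * u)) = ((1 + Real.exp (-w * u) : ℝ) : ℂ) := by push_cast; rfl
  rw [this]
  have := Real.exp_pos (-w * u)
  exact_mod_cast (by positivity)

lemma hfun_norm (w u : ℝ) : ‖hfun w u‖ ≤ 1 := by
  have : (1 + Complex.exp (-(w : ℂ) * u)) = ((1 + Real.exp (-w * u) : ℝ) : ℂ) := by push_cast; rfl
  rw [hfun, this, norm_inv, Complex.norm_real, Real.norm_eq_abs]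
  have := Real.exp_pos (-w * u)
  rw [abs_of_pos (by positivity)]
  exact inv_le_one_of_one_le₀ (by linarith)

lemma hfun_deriv (w u : ℝ) : HasDerivAt (hfun w) (w * hfun w u * (1 - hfun w u)) u := by
  have h := ((((hasDerivAt_id u).ofReal_comp.const_mul (-(w : ℂ))).cexp).const_add 1).inv (hfun_ne w u)
  convert! h using 1
  have := hfun_ne w u
  simp only [hfun, id, Complex.ofReal_one, mul_one]
  generalize Complex.exp (-(w : ℂ) * u) = E at this ⊢
  field_simp
  ring

open PowerSeries in
noncomputable def Hps (w : ℝ) : PowerSeries ℂ :=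
  PowerSeries.invOfUnit (PowerSeries.rescale (w : ℂ) (PowerSeries.exp ℂ) + 1) (twoUnit ℂ)

lemma deriv_rescale_exp (z : ℂ) :
    PowerSeries.derivative ℂ (PowerSeries.rescale z (PowerSeries.exp ℂ)) =
      PowerSeries.C z * PowerSeries.rescale z (PowerSeries.exp ℂ) := by
  ext n
  rw [PowerSeries.coeff_derivative, PowerSeries.coeff_C_mul]
  simp only [PowerSeries.coeff_rescale, PowerSeries.coeff_exp]
  have : ((n + 1).factorial : ℂ) ≠ 0 := by exact_mod_cast Nat.factorial_ne_zero _
  have : (n.factorial : ℂ) ≠ 0 := by exact_mod_cast Nat.factorial_ne_zero _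
  have : (n + 1 : ℂ) ≠ 0 := by exact_mod_cast Nat.succ_ne_zero n
  simp [Nat.factorial_succ]
  field_simp
  ring

lemma const_rescale_exp (z : ℂ) :
    PowerSeries.constantCoeff (PowerSeries.rescale z (PowerSeries.exp ℂ)) = 1 := by
  rw [← PowerSeries.coeff_zero_eq_constantCoeff_apply, PowerSeries.coeff_rescale]
  simp

lemma Hps_mul (w : ℝ) : (PowerSeries.rescale (w : ℂ) (PowerSeries.exp ℂ) + 1) * Hps w = 1 := by
  apply PowerSeries.mul_invOfUnit
  rw [map_add, const_rescale_exp, map_one]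
  norm_num [twoUnit]

lemma Hps_const (w : ℝ) : PowerSeries.constantCoeff (Hps w) = hfun w 0 := by
  simp [Hps, hfun, twoUnit]
  norm_num

lemma Hps_deriv (w : ℝ) : PowerSeries.derivative ℂ (Hps w) =
    - (PowerSeries.C (w : ℂ) * Hps w * (1 - Hps w)) := by
  have h := Hps_mul w
  have h2 := congrArg (PowerSeries.derivative ℂ) h
  rw [Derivation.leibniz, map_add, deriv_rescale_exp, Derivation.map_one_eq_zero] at h2
  simp only [smul_eq_mul, add_zero] at h2
  linear_combination (Hps w) * h2 - (PowerSeries.derivative ℂ (Hps w)) * h - PowerSeries.C (w : ℂ) * (Hps w) * h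

lemma poly_step {N : ℕ} (ω : Fin N → ℝ) (P : MvPolynomial (Fin N) ℂ) :
    ∃ Q : MvPolynomial (Fin N) ℂ,
      (∀ u, HasDerivAt (fun u => MvPolynomial.aeval (fun j => hfun (ω j) u) P)
        (MvPolynomial.aeval (fun j => hfun (ω j) u) Q) u) ∧
      PowerSeries.derivative ℂ (MvPolynomial.aeval (fun j => Hps (ω j)) P) =
        - MvPolynomial.aeval (fun j => Hps (ω j)) Q := by
  induction P using MvPolynomial.induction_on with
  | C a =>
    refine ⟨0, fun u => ?_, ?_⟩
    · simpa using hasDerivAt_const u a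
    · simp
  | add p q hp hq =>
    obtain ⟨p', h1, h2⟩ := hp
    obtain ⟨q', h3, h4⟩ := hq
    refine ⟨p' + q', fun u => ?_, ?_⟩
    · simpa [Pi.add_def] using (h1 u).add (h3 u)
    · simp only [map_add, h2, h4]; ring
  | mul_X p j hp =>
    obtain ⟨p', h1, h2⟩ := hp
    refine ⟨p' * MvPolynomial.X j + p * (MvPolynomial.C (ω j : ℂ) * MvPolynomial.X j *
      (1 - MvPolynomial.X j)), fun u => ?_, ?_⟩
    · simpa [Pi.mul_def] using (h1 u).mul (hfun_deriv (ω j) u)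
    · have e : (algebraMap ℂ (PowerSeries ℂ)) (ω j : ℂ) = PowerSeries.C (ω j : ℂ) := rfl
      simp only [map_mul, map_add, map_sub, map_one, MvPolynomial.aeval_X, MvPolynomial.aeval_C,
        Derivation.leibniz, h2, Hps_deriv, smul_eq_mul, e]
      ring

lemma poly_bdd {N : ℕ} (ω : Fin N → ℝ) (P : MvPolynomial (Fin N) ℂ) :
    ∃ C : ℝ, ∀ u, ‖MvPolynomial.aeval (fun j => hfun (ω j) u) P‖ ≤ C := by
  induction P using MvPolynomial.induction_on with
  | C a => exact ⟨‖a‖, fun u => by simp⟩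
  | add p q hp hq =>
    obtain ⟨A, hA⟩ := hp
    obtain ⟨B, hB⟩ := hq
    refine ⟨A + B, fun u => ?_⟩
    rw [map_add]
    exact (norm_add_le _ _).trans (add_le_add (hA u) (hB u))
  | mul_X p j hp =>
    obtain ⟨A, hA⟩ := hp
    refine ⟨A, fun u => ?_⟩
    rw [map_mul, MvPolynomial.aeval_X, norm_mul]
    exact (mul_le_of_le_one_right (norm_nonneg _) (hfun_norm _ _)).trans (hA u)

lemma poly_const {N : ℕ} (ω : Fin N → ℝ) (P : MvPolynomial (Fin N) ℂ) :
    PowerSeries.constantCoeff (MvPolynomial.aeval (fun j => Hps (ω j)) P) =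
      MvPolynomial.aeval (fun j => hfun (ω j) 0) P := by
  induction P using MvPolynomial.induction_on with
  | C a =>
    have e : (algebraMap ℂ (PowerSeries ℂ)) a = PowerSeries.C a := rfl
    simp [e]
  | add p q hp hq => simp [hp, hq]
  | mul_X p j hp => simp [hp, Hps_const]

noncomputable def Gf {N : ℕ} (ω : Fin N → ℝ) (x : ℂ) (P : MvPolynomial (Fin N) ℂ) (u : ℝ) : ℂ :=
  Complex.exp (-x * u) * MvPolynomial.aeval (fun j => hfun (ω j) u) P

noncomputable def Gs {N : ℕ} (ω : Fin N → ℝ) (x : ℂ) (P : MvPolynomial (Fin N) ℂ) : PowerSeries ℂ :=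
  PowerSeries.rescale x (PowerSeries.exp ℂ) * MvPolynomial.aeval (fun j => Hps (ω j)) P

lemma Gf_step {N : ℕ} (ω : Fin N → ℝ) (x : ℂ) (P : MvPolynomial (Fin N) ℂ) :
    ∃ Q : MvPolynomial (Fin N) ℂ, (∀ u, HasDerivAt (Gf ω x P) (Gf ω x Q u) u) ∧
      PowerSeries.derivative ℂ (Gs ω x P) = - Gs ω x Q := by
  obtain ⟨Q, h1, h2⟩ := poly_step ω P
  refine ⟨MvPolynomial.C (-x) * P + Q, fun u => ?_, ?_⟩
  · have := (((hasDerivAt_id u).ofReal_comp.const_mul (-x)).cexp).mul (h1 u)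
    convert! this using 1
    simp [Gf]
    ring
  · have e : (algebraMap ℂ (PowerSeries ℂ)) (-x) = -PowerSeries.C x := by
      rw [← map_neg]; rfl
    simp only [Gs, Derivation.leibniz, h2, deriv_rescale_exp, smul_eq_mul, map_add, map_mul,
      MvPolynomial.aeval_C, e]
    ring

lemma Gf_dec {N : ℕ} (ω : Fin N → ℝ) (x : ℂ) (P : MvPolynomial (Fin N) ℂ) :
    Dec x.re (Gf ω x P) := by
  obtain ⟨Q, h1, h2⟩ := Gf_step ω x P
  refine ⟨continuous_iff_continuousAt.2 fun u => (h1 u).continuousAt, ?_⟩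
  obtain ⟨C, hC⟩ := poly_bdd ω P
  refine ⟨C, fun u hu => ?_⟩
  rw [Gf, norm_mul, mul_comm, Complex.norm_exp]
  have : (-x * (u : ℂ)).re = -x.re * u := by simp
  rw [this]
  exact mul_le_mul_of_nonneg_right (hC u) (Real.exp_pos _).le

lemma Gs_const {N : ℕ} (ω : Fin N → ℝ) (x : ℂ) (P : MvPolynomial (Fin N) ℂ) :
    PowerSeries.constantCoeff (Gs ω x P) = Gf ω x P 0 := by
  rw [Gs, map_mul, const_rescale_exp, poly_const, Gf]
  simp

lemma exists_seq {N : ℕ} (ω : Fin N → ℝ) (x : ℂ) : ∃ P : ℕ → MvPolynomial (Fin N) ℂ,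
    P 0 = ∏ j, MvPolynomial.X j ∧
    (∀ m u, HasDerivAt (Gf ω x (P m)) (Gf ω x (P (m + 1)) u) u) ∧
    (∀ m, PowerSeries.derivative ℂ (Gs ω x (P m)) = - Gs ω x (P (m + 1))) := by
  choose D h1 h2 using Gf_step ω x
  refine ⟨fun m => D^[m] (∏ j, MvPolynomial.X j), rfl, fun m u => ?_, fun m => ?_⟩
  · simp only [Function.iterate_succ_apply']; exact h1 _ u
  · simp only [Function.iterate_succ_apply']; exact h2 _

lemma euler_eq {N : ℕ} (ω : Fin N → ℝ) (x : ℂ) (P : ℕ → MvPolynomial (Fin N) ℂ)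
    (h0 : P 0 = ∏ j, MvPolynomial.X j)
    (hd : ∀ m, PowerSeries.derivative ℂ (Gs ω x (P m)) = - Gs ω x (P (m + 1))) (k : ℕ) :
    eulerHO ℂ N (fun i => (ω i : ℂ)) x k / 2 ^ N = (-1) ^ k * Gf ω x (P k) 0 := by
  have h1 : ∀ k, (PowerSeries.derivative ℂ)^[k] (Gs ω x (P 0)) = (-1) ^ k * Gs ω x (P k) := by
    intro k
    induction k with
    | zero => simp
    | succ k ih =>
      rw [Function.iterate_succ_apply', ih, Derivation.leibniz, hd]
      have : PowerSeries.derivative ℂ ((-1 : PowerSeries ℂ) ^ k) = 0 := by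
        rcases neg_one_pow_eq_or (PowerSeries ℂ) k with h | h <;> simp [h]
      rw [this]
      simp [pow_succ]
  have h2 := PowerSeries.constantCoeff_iterate_derivative (Gs ω x (P 0)) k
  rw [h1, map_mul, Gs_const] at h2
  simp only [map_pow, map_neg, map_one] at h2
  rw [h2, eulerHO, PowerSeries.coeff_smul, Gs, h0, map_prod]
  simp only [MvPolynomial.aeval_X, Hps, smul_eq_mul]
  field_simp

/-! ### analysis -/

lemma exists_entire (g : ℕ → ℝ → ℂ) {a : ℝ} (ha : 0 < a) (hg : ∀ m, Dec a (g m))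
    (hd : ∀ m u, HasDerivAt (g m) (g (m + 1) u) u) :
    ∃ F : ℂ → ℂ, Differentiable ℂ F ∧
      (∀ s : ℂ, 0 < s.re → F s = (Complex.Gamma s)⁻¹ * mellin (g 0) s) ∧
      (∀ k : ℕ, F (-(k : ℂ)) = (-1) ^ k * g k 0) := by
  let Φ : ℕ → ℂ → ℂ := fun m s => (-1) ^ m * ((Complex.Gamma (s + m))⁻¹ * mellin (g m) (s + m))
  have step : ∀ (m : ℕ) (s : ℂ), (0:ℝ) < s.re + m → Φ (m + 1) s = Φ m s := by
    intro m s hs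
    have hs' : 0 < (s + m).re := by simpa using hs
    have h0 : s + m ≠ 0 := by intro h; rw [h] at hs'; simp at hs'
    have := Dec.ibp ha (hg m) (hg (m + 1)) (hd m) hs'
    simp only [Φ, Nat.cast_add, Nat.cast_one, ← add_assoc, this, Complex.Gamma_add_one _ h0, pow_succ]
    have := Complex.Gamma_ne_zero_of_re_pos hs'
    field_simp
  have step2 : ∀ (m n : ℕ) (s : ℂ), (0:ℝ) < s.re + m → Φ (m + n) s = Φ m s := by
    intro m n s hs
    induction n with
    | zero => rfl
    | succ n ih => rw [← add_assoc, step, ih]; push_cast; have := Nat.cast_nonneg (α := ℝ) n; linarith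
  have step3 : ∀ (m n : ℕ) (s : ℂ), (0:ℝ) < s.re + m → 0 < s.re + n → Φ m s = Φ n s := by
    intro m n s hm hn
    rw [← step2 m n s hm, ← step2 n m s hn, add_comm]
  let M : ℂ → ℕ := fun s => ⌈-s.re⌉₊ + 1
  have hM : ∀ s, 0 < s.re + M s := by
    intro s
    have := Nat.le_ceil (-s.re)
    simp only [M]; push_cast; linarith
  have hF : ∀ (m : ℕ) (s : ℂ), (0:ℝ) < s.re + m → Φ (M s) s = Φ m s := fun m s h => step3 _ _ _ (hM s) h
  refine ⟨fun s => Φ (M s) s, fun s => ?_, fun s hs => ?_, fun k => ?_⟩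
  · have ev : (fun s => Φ (M s) s) =ᶠ[𝓝 s] Φ (M s) := by
      have : {z : ℂ | 0 < z.re + M s} ∈ 𝓝 s :=
        (isOpen_lt continuous_const (Complex.continuous_re.add continuous_const)).mem_nhds (hM s)
      filter_upwards [this] with z hz
      exact hF _ _ hz
    refine DifferentiableAt.congr_of_eventuallyEq ?_ ev
    have d1 : DifferentiableAt ℂ (fun z : ℂ => z + (M s : ℂ)) s := by fun_prop
    have d2 := (Dec.diff ha (hg (M s)) (s := s + M s) (by simpa using hM s))
    exact ((Complex.differentiable_one_div_Gamma.differentiableAt.comp s d1).mul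
      (d2.comp s d1)).const_mul _
  · beta_reduce
    rw [hF 0 s (by simpa using hs)]
    simp [Φ]
  · beta_reduce
    rw [hF (k + 1) (-(k : ℂ)) (by simp)]
    have e : (-(k : ℂ) + ((k + 1 : ℕ) : ℂ)) = 1 := by push_cast; ring
    simp only [Φ, e]
    have c := (hg (k + 1)).conv ha (s := 1) (by simp)
    have c' : IntegrableOn (g (k + 1)) (Ioi 0) := by simpa [MellinConvergent] using c
    have t : Tendsto (g k) atTop (𝓝 0) := by
      refine (hg k).top.trans_tendsto ?_
      have := tendsto_rpow_mul_exp_neg_mul_atTop_nhds_zero 0 a ha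
      simpa using this
    have := integral_Ioi_of_hasDerivAt_of_tendsto' (a := 0) (fun u _ => hd k u) c' t
    simp [mellin, this, pow_succ]

lemma hfun_hasSum {w u : ℝ} (hw : 0 < w) (hu : 0 < u) :
    (Summable fun n : ℕ => ‖((-1 : ℂ) ^ n * Complex.exp (-(w * n : ℂ) * u))‖) ∧
    ∑' n : ℕ, ((-1 : ℂ) ^ n * Complex.exp (-(w * n : ℂ) * u)) = hfun w u := by
  have e : ∀ n : ℕ, ((-1 : ℂ) ^ n * Complex.exp (-(w * n : ℂ) * u)) =
      (-Complex.exp (-(w : ℂ) * u)) ^ n := by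
    intro n
    rw [neg_pow (Complex.exp _), ← Complex.exp_nat_mul]
    congr 2; ring
  have hlt : ‖-Complex.exp (-(w : ℂ) * u)‖ < 1 := by
    rw [norm_neg, Complex.norm_exp]
    simp
    positivity
  simp only [e]
  refine ⟨?_, ?_⟩
  · simp only [norm_pow]
    exact summable_geometric_of_lt_one (norm_nonneg _) hlt
  · rw [tsum_geometric_of_norm_lt_one hlt, hfun, sub_neg_eq_add]

lemma summable_aux {N : ℕ} (hN : 1 ≤ N) (ω : Fin N → ℝ) (hω : ∀ i, 0 < ω i) {a : ℝ} (ha : 0 < a)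
    {σ : ℝ} (hσ : (N : ℝ) < σ) :
    Summable fun t : Fin N → ℕ => (a + ∑ i, ω i * (t i : ℝ)) ^ (-σ) := by
  have hNp : (0 : ℝ) < N := by exact_mod_cast hN
  obtain ⟨δ, hδ, hδa, hδω⟩ : ∃ δ : ℝ, 0 < δ ∧ δ ≤ a ∧ ∀ i, δ ≤ ω i := by
    have : Nonempty (Fin N) := ⟨⟨0, hN⟩⟩
    obtain ⟨i0, hi0⟩ := Finite.exists_min ω
    exact ⟨min a (ω i0), lt_min ha (hω _), min_le_left _ _, fun i => (min_le_right _ _).trans (hi0 i)⟩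
  let p : ℝ := σ / N
  have hp : 1 < p := by rw [one_lt_div hNp]; exact hσ
  have hs : Summable fun n : ℕ => ‖(((δ * (n + 1 : ℝ)) ^ (-p) : ℝ) : ℂ)‖ := by
    have h1 := (summable_nat_add_iff 1).2 (Real.summable_nat_rpow.2 (show -p < -1 by linarith))
    refine (h1.mul_left (δ ^ (-p))).congr fun n => ?_
    rw [Complex.norm_real, Real.norm_of_nonneg (by positivity),
      Real.mul_rpow hδ.le (by positivity)]
    push_cast; rfl
  refine Summable.of_nonneg_of_le (fun t => ?_) (fun t => ?_)
    (hasSum_pi_prod N (fun _ n => (((δ * (n + 1 : ℝ)) ^ (-p) : ℝ) : ℂ)) (fun _ => hs)).1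
  · have : 0 ≤ ∑ i, ω i * (t i : ℝ) :=
      Finset.sum_nonneg fun i _ => mul_nonneg (hω i).le (Nat.cast_nonneg _)
    positivity
  · set S := a + ∑ i, ω i * (t i : ℝ) with hS
    have hi : ∀ i, δ * (t i + 1 : ℝ) ≤ S := by
      intro i
      have h1 : ω i * (t i : ℝ) ≤ ∑ i, ω i * (t i : ℝ) :=
        Finset.single_le_sum (f := fun i => ω i * (t i : ℝ))
          (fun i _ => mul_nonneg (hω i).le (Nat.cast_nonneg _)) (Finset.mem_univ i)
      have h2 := mul_le_mul_of_nonneg_right (hδω i) (Nat.cast_nonneg (α := ℝ) (t i))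
      linarith
    have hSp : 0 < S := lt_of_lt_of_le (by positivity) (hi ⟨0, hN⟩)
    have e : S ^ (-σ) = ∏ _i : Fin N, S ^ (-p) := by
      rw [Finset.prod_const, Finset.card_univ, Fintype.card_fin, ← Real.rpow_natCast,
        ← Real.rpow_mul hSp.le]
      congr 1
      simp only [p]; field_simp
    rw [e, norm_prod]
    refine Finset.prod_le_prod (fun i _ => by positivity) (fun i _ => ?_)
    rw [Complex.norm_real, Real.norm_of_nonneg (by positivity)]
    exact Real.rpow_le_rpow_of_nonpos (by positivity) (hi i) (by linarith)

lemma mellin_sum {N : ℕ} (hN : 1 ≤ N) (ω : Fin N → ℝ) (hω : ∀ i, 0 < ω i)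
    (x : ℂ) (hx : 0 < x.re) (s : ℂ) (hs : (N : ℝ) < s.re) :
    mellin (Gf ω x (∏ j, MvPolynomial.X j)) s = Complex.Gamma s * zetaE N ω x s := by
  have hs0 : 0 < s.re := lt_of_le_of_lt (Nat.cast_nonneg _) hs
  let r : (Fin N → ℕ) → ℂ := fun t => x + ∑ i, (ω i : ℂ) * (t i : ℂ)
  have hre : ∀ t, (r t).re = x.re + ∑ i, ω i * (t i : ℝ) := by
    intro t; simp [r]
  have hrpos : ∀ t, 0 < (r t).re := by
    intro t
    rw [hre]
    have : 0 ≤ ∑ i, ω i * (t i : ℝ) :=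
      Finset.sum_nonneg fun i _ => mul_nonneg (hω i).le (Nat.cast_nonneg _)
    positivity
  have hsum : ∀ u : ℝ, 0 < u → HasSum (fun t : Fin N → ℕ =>
      (-1 : ℂ) ^ (∑ i, t i) * Complex.exp (-r t * u)) (Gf ω x (∏ j, MvPolynomial.X j) u) := by
    intro u hu
    have h := (hasSum_pi_prod N (fun i n => ((-1 : ℂ) ^ n * Complex.exp (-(ω i * n : ℂ) * u)))
      (fun i => (hfun_hasSum (hω i) hu).1)).2.mul_left (Complex.exp (-x * u))
    have e2 : Gf ω x (∏ j, MvPolynomial.X j) u = Complex.exp (-x * u) *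
        ∏ i, ∑' n : ℕ, ((-1 : ℂ) ^ n * Complex.exp (-(ω i * n : ℂ) * u)) := by
      simp only [Gf, map_prod, MvPolynomial.aeval_X]
      congr 1
      exact Finset.prod_congr rfl fun i _ => (hfun_hasSum (hω i) hu).2.symm
    rw [e2]
    convert! h using 2 with t
    rw [Finset.prod_mul_distrib, Finset.prod_pow_eq_pow_sum, ← Complex.exp_sum, mul_left_comm,
      ← Complex.exp_add]
    congr 2
    simp only [r, ← Finset.sum_mul, Finset.sum_neg_distrib]
    ring
  have hconv : ∀ t, MellinConvergent (fun u : ℝ => Complex.exp (-r t * u)) s :=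
    fun t => (dec_exp le_rfl).conv (hrpos t) hs0
  have main := hasSum_integral_of_summable_integral_norm (μ := volume.restrict (Ioi (0:ℝ)))
    (F := fun (t : Fin N → ℕ) (u : ℝ) =>
      (-1 : ℂ) ^ (∑ i, t i) * ((u : ℂ) ^ (s - 1) * Complex.exp (-r t * u)))
    (fun t => (hconv t).const_mul _) ?_
  · have e1 : ∀ t : Fin N → ℕ, ∫ u : ℝ in Ioi 0, (-1 : ℂ) ^ (∑ i, t i) *
        ((u : ℂ) ^ (s - 1) * Complex.exp (-r t * u)) =
        Complex.Gamma s * ((-1 : ℂ) ^ (∑ i, t i) * (r t) ^ (-s)) := by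
      intro t
      rw [integral_const_mul]
      have := mellin_exp (hrpos t) hs0
      simp only [mellin, smul_eq_mul] at this
      rw [this]; ring
    simp only [e1] at main
    have e2 : mellin (Gf ω x (∏ j, MvPolynomial.X j)) s = ∫ u : ℝ in Ioi 0, ∑' t : Fin N → ℕ,
        (-1 : ℂ) ^ (∑ i, t i) * ((u : ℂ) ^ (s - 1) * Complex.exp (-r t * u)) := by
      refine setIntegral_congr_fun measurableSet_Ioi fun u hu => ?_
      simp only [smul_eq_mul, mul_left_comm _ ((u : ℂ) ^ (s - 1))]
      exact ((hsum u hu).mul_left _).tsum_eq.symm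
    rw [e2, ← main.tsum_eq, tsum_mul_left]
    rfl
  · have := (summable_aux hN ω hω hx hs).mul_left (Real.Gamma s.re)
    refine this.congr fun t => ?_
    have hr := Real.integral_rpow_mul_exp_neg_mul_Ioi hs0 (hrpos t)
    rw [← hre, Real.rpow_neg (hrpos t).le, ← Real.inv_rpow (hrpos t).le, ← one_div, mul_comm, ← hr]
    refine setIntegral_congr_fun measurableSet_Ioi fun u hu => ?_
    simp only [norm_mul, norm_pow, norm_neg, norm_one, one_pow, one_mul]
    rw [Complex.norm_cpow_eq_rpow_re_of_pos hu, Complex.norm_exp]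
    simp

theorem stmt7 (N : ℕ) (hN : 1 ≤ N) (ω : Fin N → ℝ) (hω : ∀ i, 0 < ω i)
    (x : ℂ) (hx : 0 < x.re) :
    ∃ F : ℂ → ℂ, Differentiable ℂ F ∧
      (∀ s : ℂ, (N : ℝ) < s.re → F s = zetaE N ω x s) ∧
      (∀ k : ℕ, F (-(k : ℂ)) = eulerHO ℂ N (fun i => (ω i : ℂ)) x k / 2 ^ N) := by
  obtain ⟨P, h0, h1, h2⟩ := exists_seq ω x
  obtain ⟨F, hF, hF1, hF2⟩ := exists_entire (fun m => Gf ω x (P m)) hx (fun m => Gf_dec ω x _) h1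
  refine ⟨F, hF, fun s hs => ?_, fun k => ?_⟩
  · have hs0 : 0 < s.re := lt_of_le_of_lt (Nat.cast_nonneg _) hs
    rw [hF1 s hs0, h0, mellin_sum hN ω hω x hx s hs, inv_mul_cancel_left₀]
    exact Complex.Gamma_ne_zero_of_re_pos hs0
  · rw [hF2, euler_eq ω x P h0 h2]
end

section
/- Let p be an odd prime and K as below. Let k ≥ 1, let x, ω₁,…,ω_k ∈ K, and let n ∈ ℕ. Then, as l → ∞, the alternating sums ∑_{t=0}^{p^l−1} (−1)^t·E_{k−1,n}(x + t·ω_k; ω₁,…,ω_{k−1}) converge in K to E_{k,n}(x; ω₁,…,ω_k). -/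
theorem eulerHO_rec (A : Type*) [Field A] [Algebra ℚ A] (k : ℕ) (ω : Fin (k + 1) → A) (y : A)
    (n : ℕ) : eulerHO A (k + 1) ω y n + eulerHO A (k + 1) ω (y + ω (Fin.last k)) n
      = 2 * eulerHO A k (fun i => ω i.castSucc) y n := by
  unfold eulerHO
  rw [← mul_add, ← map_add, Fin.prod_univ_castSucc, ← PowerSeries.exp_mul_exp_eq_exp_add,
    ← smul_add]
  have hu : (PowerSeries.rescale (ω (Fin.last k)) (PowerSeries.exp A) + 1) *
      PowerSeries.invOfUnit (PowerSeries.rescale (ω (Fin.last k)) (PowerSeries.exp A) + 1)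
        (twoUnit A) = 1 := by
    apply PowerSeries.mul_invOfUnit
    rw [map_add, ← PowerSeries.coeff_zero_eq_constantCoeff_apply, PowerSeries.coeff_rescale]
    simp [twoUnit]
    norm_num
  generalize PowerSeries.invOfUnit (PowerSeries.rescale (ω (Fin.last k)) (PowerSeries.exp A) + 1)
        (twoUnit A) = U at *
  generalize PowerSeries.rescale (ω (Fin.last k)) (PowerSeries.exp A) = W at *
  generalize PowerSeries.rescale y (PowerSeries.exp A) = Y at *
  generalize (∏ j : Fin k, PowerSeries.invOfUnit
    (PowerSeries.rescale (ω j.castSucc) (PowerSeries.exp A) + 1) (twoUnit A)) = P at *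
  have : Y * (P * U) + Y * W * (P * U) = Y * P := by linear_combination Y * P * hu
  rw [this, PowerSeries.coeff_smul, PowerSeries.coeff_smul]
  simp only [smul_eq_mul]
  ring

theorem eulerHO_cont (K : Type*) [NontriviallyNormedField K] [Algebra ℚ K]
    (k : ℕ) (ω : Fin k → K) (n : ℕ) : Continuous (fun y => eulerHO K k ω y n) := by
  unfold eulerHO
  simp only [PowerSeries.coeff_smul, PowerSeries.coeff_mul, PowerSeries.coeff_rescale, smul_eq_mul]
  fun_prop

theorem eulerHO_tele (A : Type*) [Field A] [Algebra ℚ A] (k : ℕ) (ω : Fin (k + 1) → A) (x : A)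
    (n m : ℕ) : 2 * ∑ t ∈ Finset.range m,
        (-1 : A) ^ t * eulerHO A k (fun i => ω i.castSucc) (x + (t : A) * ω (Fin.last k)) n
      = eulerHO A (k + 1) ω x n - (-1) ^ m * eulerHO A (k + 1) ω (x + m * ω (Fin.last k)) n := by
  induction m with
  | zero => simp
  | succ m ih =>
    have h := eulerHO_rec A k ω (x + m * ω (Fin.last k)) n
    rw [Finset.sum_range_succ, mul_add, ih]
    rw [show x + m * ω (Fin.last k) + ω (Fin.last k) = x + ((m + 1 : ℕ) : A) * ω (Fin.last k) by
      push_cast; ring] at h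
    rw [pow_succ]
    linear_combination -(-1) ^ m * h

/-- Let `p` be an odd prime and `K` a complete nontrivially normed
ultrametric field which is a normed `ℚ_[p]`-algebra (hence of characteristic zero, so a
`ℚ`-algebra). For `k ≥ 1` (here the index `k` of the statement is `k+1`), `x, ω₁,…,ω_{k+1} ∈ K`
and `n ∈ ℕ`, the alternating sums `∑_{t=0}^{p^l−1} (−1)^t E_{k,n}(x + t·ω_{k+1}; ω₁,…,ω_k)`
converge, as `l → ∞`, to `E_{k+1,n}(x; ω₁,…,ω_{k+1})`. -/
theorem stmt8 (p : ℕ) [Fact p.Prime] (hp : p ≠ 2)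
    (K : Type*) [NontriviallyNormedField K] [CompleteSpace K]
    [NormedAlgebra ℚ_[p] K] [IsUltrametricDist K] [CharZero K]
    (k : ℕ) (ω : Fin (k + 1) → K) (x : K) (n : ℕ) :
    Filter.Tendsto (fun l : ℕ => ∑ t ∈ Finset.range (p ^ l),
        (-1 : K) ^ t * eulerHO K k (fun i => ω i.castSucc) (x + (t : K) * ω (Fin.last k)) n)
      Filter.atTop (nhds (eulerHO K (k + 1) ω x n)) := by
  have hodd : Odd p := (Fact.out : p.Prime).odd_of_ne_two hp
  have h0 : Filter.Tendsto (fun l : ℕ => ((p ^ l : ℕ) : K)) Filter.atTop (nhds 0) := by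
    have hn : ‖(p : K)‖ < 1 := by
      have : (p : K) = algebraMap ℚ_[p] K (p : ℚ_[p]) := by simp
      rw [this, norm_algebraMap', Padic.norm_p]
      exact inv_lt_one_of_one_lt₀ (by exact_mod_cast (Fact.out : p.Prime).one_lt)
    simpa using tendsto_pow_atTop_nhds_zero_of_norm_lt_one hn
  have h1 : Filter.Tendsto (fun l : ℕ => x + ((p ^ l : ℕ) : K) * ω (Fin.last k))
      Filter.atTop (nhds x) := by
    simpa using (h0.mul_const (ω (Fin.last k))).const_add x
  have h2 := ((eulerHO_cont K (k + 1) ω n).tendsto x).comp h1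
  have h3 := (h2.const_add (eulerHO K (k + 1) ω x n)).const_mul (2⁻¹ : K)
  have h20 : (2 : K) ≠ 0 := two_ne_zero
  have e : (2⁻¹ : K) * (eulerHO K (k + 1) ω x n + eulerHO K (k + 1) ω x n)
      = eulerHO K (k + 1) ω x n := by field_simp; ring
  rw [e] at h3
  refine h3.congr fun l => ?_
  have ht := eulerHO_tele K k ω x n (p ^ l)
  rw [(hodd.pow).neg_one_pow] at ht
  simp only [Function.comp_apply]
  rw [inv_mul_eq_iff_eq_mul₀ h20, ht]
  ring
end

section
/- Let p be an odd prime and K as below. Let N ≥ 1, let x, ω₁,…,ω_N ∈ K, and let n ∈ ℕ. Then, as l → ∞, the N-fold alternating sums ∑_{t₁=0}^{p^l−1}⋯∑_{t_N=0}^{p^l−1} (−1)^{t₁+⋯+t_N}·(x + ω₁t₁ + ⋯ + ω_N t_N)^n converge in K to E_{N,n}(x; ω₁,…,ω_N). (This realizes the N-fold fermionic p-adic integral of (x+ω̄·t̄)^n as the higher-order Euler polynomial E_{N,n}(x;ω̄).) -/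
open PowerSeries in
theorem aux_sum {K : Type*} [Field K] [CharZero K] {ι : Type*} (s : Finset ι) (f : ι → K) :
    rescale (∑ i ∈ s, f i) (exp K) = ∏ i ∈ s, rescale (f i) (exp K) := by
  classical
  induction s using Finset.induction_on with
  | empty => 
    ext k
    rcases k with _ | k <;> simp [coeff_rescale, coeff_exp, coeff_one]
  | insert a s ha ih => rw [Finset.sum_insert ha, Finset.prod_insert ha, ← ih, exp_mul_exp_eq_exp_add]

open PowerSeries in
theorem aux_coeff {K : Type*} [Field K] [CharZero K] (y : K) (n : ℕ) :
    (n.factorial : K) * coeff n (rescale y (exp K)) = y ^ n := by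
  have : (n.factorial : K) ≠ 0 := by exact_mod_cast n.factorial_ne_zero
  simp only [coeff_rescale, coeff_exp, map_div₀, map_one, map_natCast]
  field_simp

open PowerSeries in
theorem aux_geom {K : Type*} [Field K] [CharZero K] (w : K) (m : ℕ) :
    (∑ t ∈ Finset.range m, (-1 : K⟦X⟧) ^ t * rescale (w * (t : K)) (exp K)) *
      (rescale w (exp K) + 1) = 1 - (-1) ^ m * rescale (w * (m : K)) (exp K) := by
  induction m with
  | zero => simp
  | succ m ih =>
    rw [Finset.sum_range_succ, add_mul, ih]
    have : rescale (w * ((m + 1 : ℕ) : K)) (exp K) =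
        rescale (w * (m : K)) (exp K) * rescale w (exp K) := by
      rw [exp_mul_exp_eq_exp_add]; congr 2; push_cast; ring
    rw [this]; ring

open PowerSeries in
theorem aux_geom' {K : Type*} [Field K] [CharZero K] (w : K) (m : ℕ) (hm : Odd m) :
    (∑ t ∈ Finset.range m, (-1 : K⟦X⟧) ^ t * rescale (w * (t : K)) (exp K)) =
      (1 + rescale (w * (m : K)) (exp K)) * invOfUnit (rescale w (exp K) + 1) (twoUnit K) := by
  have h := aux_geom w m
  rw [hm.neg_one_pow] at h
  have h2 : (rescale w (exp K) + 1) * invOfUnit (rescale w (exp K) + 1) (twoUnit K) = 1 := by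
    apply mul_invOfUnit
    simp only [map_add, map_one, ← coeff_zero_eq_constantCoeff_apply, coeff_rescale, coeff_exp, twoUnit]
    norm_num
  rw [show 1 + rescale (w * (m : K)) (exp K) = 1 - (-1) * rescale (w * (m : K)) (exp K) by ring, ← h,
    mul_assoc, h2, mul_one]

open PowerSeries PowerSeries.WithPiTopology in
theorem stmt9_aux (p : ℕ) [Fact p.Prime] (hp : p ≠ 2)
    (K : Type*) [NontriviallyNormedField K] [CompleteSpace K]
    [NormedAlgebra ℚ_[p] K] [IsUltrametricDist K] [CharZero K]
    (N : ℕ) (hN : 1 ≤ N) (ω : Fin N → K) (x : K) (n : ℕ) :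
    Filter.Tendsto (fun l : ℕ =>
        ∑ t ∈ Fintype.piFinset (fun _ : Fin N => Finset.range (p ^ l)),
          (-1 : K) ^ (∑ i, t i) * (x + ∑ i, ω i * (t i : K)) ^ n)
      Filter.atTop (nhds (eulerHO K N ω x n)) := by
  classical
  have hpodd : Odd p := (Fact.out : p.Prime).odd_of_ne_two hp
  have hp0 : Filter.Tendsto (fun l : ℕ => ((p ^ l : ℕ) : K)) Filter.atTop (nhds 0) := by
    have h : ‖(p : K)‖ < 1 := by
      have : (p : K) = algebraMap ℚ_[p] K (p : ℚ_[p]) := by simp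
      rw [this, norm_algebraMap']
      exact Padic.norm_p_lt_one
    simpa using tendsto_pow_atTop_nhds_zero_of_norm_lt_one h
  have hfac : ∀ w : K, Filter.Tendsto (fun l : ℕ =>
      (1 : K⟦X⟧) + rescale (w * ((p ^ l : ℕ) : K)) (exp K)) Filter.atTop (nhds 2) := by
    intro w
    rw [tendsto_iff_coeff_tendsto]
    intro d
    have hw := ((hp0.const_mul w).pow d).mul_const (algebraMap ℚ K (1 / d.factorial))
    have := hw.const_add (coeff d (1 : K⟦X⟧))
    have h2 : coeff d (2 : K⟦X⟧) = coeff d (1 : K⟦X⟧) +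
        (w * 0) ^ d * algebraMap ℚ K (1 / d.factorial) := by
      rw [show (2 : K⟦X⟧) = 1 + 1 by norm_num, map_add]
      rcases d with _ | d <;> simp [coeff_one]
    rw [h2]
    simpa only [map_add, coeff_rescale, coeff_exp] using this
  have hlim : Filter.Tendsto (fun l : ℕ => rescale x (exp K) * ∏ j : Fin N,
      (((1 : K⟦X⟧) + rescale (ω j * ((p ^ l : ℕ) : K)) (exp K)) *
        invOfUnit (rescale (ω j) (exp K) + 1) (twoUnit K))) Filter.atTop
      (nhds (rescale x (exp K) * ∏ j : Fin N,
        ((2 : K⟦X⟧) * invOfUnit (rescale (ω j) (exp K) + 1) (twoUnit K)))) :=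
    (tendsto_finsetProd _ fun j _ => (hfac (ω j)).mul_const _).const_mul _
  have hc := ((tendsto_iff_coeff_tendsto _ _ _ _).1 hlim n).const_mul (n.factorial : K)
  have hE : eulerHO K N ω x n = (n.factorial : K) * coeff n (rescale x (exp K) * ∏ j : Fin N,
        ((2 : K⟦X⟧) * invOfUnit (rescale (ω j) (exp K) + 1) (twoUnit K))) := by
    unfold eulerHO
    congr 2
    have hC2 : (C (2 : K) : K⟦X⟧) = 2 := map_ofNat C 2
    rw [Finset.prod_mul_distrib, smul_eq_C_mul, map_pow, hC2]
    simp
    ring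
  rw [hE]
  refine hc.congr fun l => ?_
  simp_rw [← fun j => aux_geom' (ω j) (p ^ l) hpodd.pow]
  rw [Finset.prod_univ_sum, Finset.mul_sum, map_sum, Finset.mul_sum]
  refine Finset.sum_congr rfl fun t _ => ?_
  rw [Finset.prod_mul_distrib, ← aux_sum, Finset.prod_pow_eq_pow_sum, mul_left_comm,
    exp_mul_exp_eq_exp_add, ← aux_coeff (x + _) n]
  rw [show (-1 : K⟦X⟧) ^ (∑ i, t i) = C ((-1 : K) ^ (∑ i, t i)) by simp, coeff_C_mul]
  ring

/-- Let `p` be an odd prime and `K` a complete nontrivially normed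
ultrametric field which is a normed `ℚ_[p]`-algebra. For `N ≥ 1`, `x, ω₁,…,ω_N ∈ K` and
`n ∈ ℕ`, the `N`-fold alternating sums
`∑_{t₁=0}^{p^l−1}⋯∑_{t_N=0}^{p^l−1} (−1)^{t₁+⋯+t_N} (x + ω₁t₁ + ⋯ + ω_N t_N)^n`
converge, as `l → ∞`, to the higher-order Euler polynomial `E_{N,n}(x; ω₁,…,ω_N)`. -/
theorem stmt9 (p : ℕ) [Fact p.Prime] (hp : p ≠ 2)
    (K : Type*) [NontriviallyNormedField K] [CompleteSpace K]
    [NormedAlgebra ℚ_[p] K] [IsUltrametricDist K] [CharZero K]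
    (N : ℕ) (hN : 1 ≤ N) (ω : Fin N → K) (x : K) (n : ℕ) :
    Filter.Tendsto (fun l : ℕ =>
        ∑ t ∈ Fintype.piFinset (fun _ : Fin N => Finset.range (p ^ l)),
          (-1 : K) ^ (∑ i, t i) * (x + ∑ i, ω i * (t i : K)) ^ n)
      Filter.atTop (nhds (eulerHO K N ω x n)) := by
  exact stmt9_aux p hp K N hN ω x n
end

section
/- Let A be a commutative ℚ-algebra, let N ≥ 1, let x, ω₁,…,ω_N ∈ A, let k ∈ ℕ, and let m be a positive odd integer. Then E_{N,k}(x; ω̄) = m^k · ∑_{j̄} (−1)^{j₁+⋯+j_N} · E_{N,k}((x + j₁ω₁ + ⋯ + j_Nω_N)/m; ω̄), where the sum is over all vectors j̄=(j₁,…,j_N) of integers with 0 ≤ j_i < m, and division by m means multiplication by the inverse of m·1_A. -/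
open PowerSeries in
theorem eu_inv (A : Type*) [CommRing A] [Algebra ℚ A] (w : A) :
    (rescale w (exp A) + 1) * invOfUnit (rescale w (exp A) + 1) (twoUnit A) = 1 := by
  apply mul_invOfUnit
  rw [← coeff_zero_eq_constantCoeff_apply]
  rw [map_add, coeff_rescale, coeff_exp, coeff_zero_one]
  simp [twoUnit]
  norm_num

open PowerSeries in
theorem eu_pow (A : Type*) [CommRing A] [Algebra ℚ A] (w : A) (n : ℕ) :
    rescale ((n : A) * w) (exp A) = (rescale w (exp A)) ^ n := by
  rw [← map_pow, exp_pow_eq_rescale_exp, rescale_rescale]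

open PowerSeries in
theorem eu_sum (A : Type*) [CommRing A] [Algebra ℚ A] {ι : Type*} (s : Finset ι) (f : ι → A) :
    rescale (∑ i ∈ s, f i) (exp A) = ∏ i ∈ s, rescale (f i) (exp A) := by
  classical
  induction s using Finset.induction_on with
  | empty => simp
  | insert a s ha ih => rw [Finset.sum_insert ha, Finset.prod_insert ha, ← ih,
      exp_mul_exp_eq_exp_add]

open PowerSeries in
theorem eu_key (A : Type*) [CommRing A] [Algebra ℚ A] (w : A) (m : ℕ) (hmo : Odd m) :
    invOfUnit (rescale w (exp A) + 1) (twoUnit A) =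
    (∑ l ∈ Finset.range m, (-1) ^ l * (rescale w (exp A)) ^ l) *
      rescale (m : A) (invOfUnit (rescale w (exp A) + 1) (twoUnit A)) := by
  have h1 := eu_inv A w
  have h2 := congrArg (rescale (m : A)) h1
  rw [map_mul, map_add, map_one, rescale_rescale, mul_comm w, eu_pow] at h2
  have h3 := geom_sum_mul (-(rescale w (exp A))) m
  rw [hmo.neg_pow] at h3
  have h4 : ∀ l, (-(rescale w (exp A))) ^ l = (-1) ^ l * (rescale w (exp A)) ^ l :=
    fun l => neg_pow _ _
  simp only [h4] at h3
  generalize rescale (m : A) (invOfUnit (rescale w (exp A) + 1) (twoUnit A)) = J at *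
  generalize invOfUnit (rescale w (exp A) + 1) (twoUnit A) = I at *
  generalize (∑ l ∈ Finset.range m, (-1) ^ l * (rescale w (exp A)) ^ l) = S at *
  generalize rescale w (exp A) = E at *
  linear_combination (-I) * h2 + S * J * h1 + I * J * h3

open PowerSeries in
/-- Distribution relation: for a commutative `ℚ`-algebra `A`, `N ≥ 1`,
`x, ω₁,…,ω_N ∈ A`, `k ∈ ℕ` and a positive odd integer `m`,
`E_{N,k}(x;ω̄) = m^k ∑_{0 ≤ jᵢ < m} (−1)^{j₁+⋯+j_N} E_{N,k}((x + j₁ω₁+⋯+j_Nω_N)/m; ω̄)`,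
where division by `m` is multiplication by the inverse of `m·1_A`. -/
theorem stmt10 (A : Type*) [CommRing A] [Algebra ℚ A] (N : ℕ) (hN : 1 ≤ N)
    (ω : Fin N → A) (x : A) (k : ℕ) (m : ℕ) (hm : 0 < m) (hmo : Odd m) :
    eulerHO A N ω x k = (m : A) ^ k *
      ∑ j ∈ Fintype.piFinset (fun _ : Fin N => Finset.range m),
        (-1 : A) ^ (∑ i, j i) *
          eulerHO A N ω (Ring.inverse (m : A) * (x + ∑ i, (j i : A) * ω i)) k := by
  have hu : IsUnit (m : A) := by
    have := (IsUnit.mk0 (m : ℚ) (by positivity)).map (algebraMap ℚ A)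
    simpa using this
  have hinv : ∀ y : A, (Ring.inverse (m : A) * y) * m = y := fun y => by
    rw [mul_right_comm, Ring.inverse_mul_cancel _ hu, one_mul]
  have key : ∀ y : A, (m : A) ^ k * eulerHO A N ω (Ring.inverse (m : A) * y) k =
      (k.factorial : A) * (2 ^ N * coeff k (rescale y (exp A) *
        ∏ i, rescale (m : A) (invOfUnit (rescale (ω i) (exp A) + 1) (twoUnit A)))) := by
    intro y
    rw [← map_prod]
    nth_rewrite 2 [← hinv y]
    rw [← rescale_rescale, ← map_mul, coeff_rescale, eulerHO, coeff_smul]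
    simp only [smul_eq_mul]
    ring
  have hser : rescale x (exp A) *
        ∏ i, invOfUnit (rescale (ω i) (exp A) + 1) (twoUnit A) =
      ∑ j ∈ Fintype.piFinset (fun _ : Fin N => Finset.range m),
        C ((-1 : A) ^ (∑ i, j i)) * (rescale (x + ∑ i, (j i : A) * ω i) (exp A) *
        ∏ i, rescale (m : A) (invOfUnit (rescale (ω i) (exp A) + 1) (twoUnit A))) := by
    rw [Finset.prod_congr rfl (fun i _ => eu_key A (ω i) m hmo), Finset.prod_mul_distrib,
      Finset.prod_univ_sum, Finset.sum_mul, Finset.mul_sum]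
    refine Finset.sum_congr rfl fun j _ => ?_
    rw [← exp_mul_exp_eq_exp_add, eu_sum, Finset.prod_mul_distrib, Finset.prod_pow_eq_pow_sum]
    simp only [eu_pow, map_pow, map_neg, map_one]
    ring
  rw [Finset.mul_sum]
  simp only [mul_left_comm ((m : A) ^ k), key]
  rw [eulerHO, hser, coeff_smul, map_sum, smul_eq_mul, Finset.mul_sum, Finset.mul_sum]
  refine Finset.sum_congr rfl fun j _ => ?_
  rw [coeff_C_mul]
  ring
end

section
/- Let p be an odd prime and K as below. Let N ≥ 1, k ≥ 1, let ω₁,…,ω_N ∈ K, and set R = max_{1≤i≤N} ‖ω_i‖. For y ∈ K with ‖y‖ > R define g_k(y) = ∑_{j=0}^∞ C(−k,j)·E_{N,j}(0;ω̄)·y^{−k−j}, where C(−k,j) = (−1)^j·binom(k+j−1,j) ∈ ℤ (this family is summable whenever ‖y‖ > R). Then for every x ∈ K with ‖x‖ > R, the function g_k has a derivative at x (in the sense of HasDerivAt over the normed field K, the function being defined on the open set {y : ‖y‖ > R}) equal to −k·g_{k+1}(x). -/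
/-- The generalized binomial coefficient `binom(−k, j) = (−1)^j·binom(k+j−1, j)`. -/
def genBinom (k j : ℕ) : ℤ := (-1) ^ j * ((k + j - 1).choose j)

/-- The function `g_k(y) = ∑_{j=0}^∞ binom(−k,j)·E_{N,j}(0;ω̄)·y^{−k−j}`. -/
noncomputable def gfun (K : Type*) [NontriviallyNormedField K] [CharZero K]
    (N : ℕ) (ω : Fin N → K) (k : ℕ) (y : K) : K :=
  ∑' j : ℕ, (genBinom k j : K) * eulerHO K N ω 0 j * y ^ (-(k : ℤ) - (j : ℤ))

noncomputable def fc18 {A : Type*} [CommRing A] (f : PowerSeries A) (n : ℕ) : A :=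
  (n.factorial : A) * PowerSeries.coeff n f

lemma fc18_mul {A : Type*} [CommRing A] (f g : PowerSeries A) (n : ℕ) :
    fc18 (f * g) n = ∑ q ∈ Finset.HasAntidiagonal.antidiagonal n,
      (n.choose q.1 : A) * (fc18 f q.1 * fc18 g q.2) := by
  unfold fc18
  rw [PowerSeries.coeff_mul, Finset.mul_sum]
  refine Finset.sum_congr rfl fun q hq => ?_
  have h := Finset.HasAntidiagonal.mem_antidiagonal.mp hq
  have h2 := Nat.add_choose_mul_factorial_mul_factorial q.1 q.2
  have h3 : n.choose q.1 = n.choose q.2 := by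
    rw [← h]; exact Nat.choose_symm_add
  rw [h] at h2
  rw [← h2, h3]
  push_cast
  ring

lemma good18_term {K : Type*} [NontriviallyNormedField K] [IsUltrametricDist K] {R : ℝ}
    (hR : 0 ≤ R) (m a b : ℕ) (u v : K) (hu : ‖u‖ ≤ R ^ a) (hv : ‖v‖ ≤ R ^ b) :
    ‖(m : K) * (u * v)‖ ≤ R ^ (a + b) := by
  rw [norm_mul, norm_mul, pow_add]
  calc ‖(m : K)‖ * (‖u‖ * ‖v‖) ≤ 1 * (R ^ a * R ^ b) := by
        gcongr
        exact IsUltrametricDist.norm_natCast_le_one K m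
    _ = _ := one_mul _

lemma good18_mul {K : Type*} [NontriviallyNormedField K] [IsUltrametricDist K] {R : ℝ}
    (hR : 0 ≤ R) (f g : PowerSeries K) (hf : ∀ n, ‖fc18 f n‖ ≤ R ^ n)
    (hg : ∀ n, ‖fc18 g n‖ ≤ R ^ n) (n : ℕ) : ‖fc18 (f * g) n‖ ≤ R ^ n := by
  rw [fc18_mul]
  refine IsUltrametricDist.norm_sum_le_of_forall_le_of_nonneg (by positivity) fun q hq => ?_
  have h := Finset.HasAntidiagonal.mem_antidiagonal.mp hq
  rw [← h]
  exact good18_term hR _ _ _ _ _ (hf _) (hg _)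

lemma good18_one {K : Type*} [NontriviallyNormedField K] {R : ℝ}
    (hR : 0 ≤ R) (n : ℕ) : ‖fc18 (1 : PowerSeries K) n‖ ≤ R ^ n := by
  unfold fc18
  rw [PowerSeries.coeff_one]
  split_ifs with h
  · subst h; simp
  · simp; positivity

lemma good18_inv {K : Type*} [NontriviallyNormedField K] [IsUltrametricDist K] [CharZero K] {R : ℝ}
    (hR : 0 ≤ R) (h2 : ‖(2 : K)‖ = 1) (f : PowerSeries K) (u : Kˣ)
    (hu : PowerSeries.constantCoeff f = u) (hu2 : (u : K) = 2)
    (hf : ∀ n, ‖fc18 f n‖ ≤ R ^ n) (n : ℕ) :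
    ‖fc18 (PowerSeries.invOfUnit f u) n‖ ≤ R ^ n := by
  induction n using Nat.strong_induction_on with
  | _ n ih =>
    have h1 := fc18_mul f (PowerSeries.invOfUnit f u) n
    rw [PowerSeries.mul_invOfUnit f u hu,
      ← Finset.add_sum_erase _ _ (a := (0, n)) (by simp)] at h1
    have h0 : fc18 f 0 = 2 := by
      simp [fc18, hu, hu2]
    simp only [h0, Nat.choose_zero_right, Nat.cast_one, one_mul] at h1
    have h3 := eq_sub_of_add_eq h1.symm
    have h4 : ‖fc18 (PowerSeries.invOfUnit f u) n‖
        = ‖2 * fc18 (PowerSeries.invOfUnit f u) n‖ := by rw [norm_mul, h2, one_mul]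
    rw [h4, h3, sub_eq_add_neg]
    refine (IsUltrametricDist.norm_add_le_max _ _).trans (max_le (good18_one hR n) ?_)
    rw [norm_neg]
    refine IsUltrametricDist.norm_sum_le_of_forall_le_of_nonneg (by positivity) fun q hq => ?_
    obtain ⟨hq1, hq2⟩ := Finset.mem_erase.mp hq
    have h := Finset.HasAntidiagonal.mem_antidiagonal.mp hq2
    rw [← h]
    refine good18_term hR _ _ _ _ _ (hf _) (ih _ ?_)
    by_contra hc
    exact hq1 (Prod.ext (by simp; omega) (by simp; omega))

lemma euler18_bound {K : Type*} [NontriviallyNormedField K] [IsUltrametricDist K] [CharZero K]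
    {R : ℝ} (hR : 0 ≤ R) (h2 : ‖(2 : K)‖ = 1) (N : ℕ) (ω : Fin N → K)
    (hω : ∀ i, ‖ω i‖ ≤ R) (n : ℕ) : ‖eulerHO K N ω 0 n‖ ≤ R ^ n := by
  have hexp : ∀ w : K, ∀ n, fc18 (PowerSeries.rescale w (PowerSeries.exp K)) n = w ^ n := by
    intro w n
    have : (n.factorial : K) ≠ 0 := by exact_mod_cast n.factorial_ne_zero
    simp [fc18, PowerSeries.coeff_rescale, PowerSeries.coeff_exp]
    field_simp
  have hprod : ∀ s : Finset (Fin N), ∀ n, ‖fc18 (∏ j ∈ s,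
      PowerSeries.invOfUnit (PowerSeries.rescale (ω j) (PowerSeries.exp K) + 1) (twoUnit K)) n‖
      ≤ R ^ n := by
    intro s
    induction s using Finset.induction_on with
    | empty => simpa using good18_one hR
    | insert a s ha ih =>
      rw [Finset.prod_insert ha]
      refine good18_mul hR _ _ (good18_inv hR h2 _ _ ?_ rfl ?_) ih
      · have h0 := hexp (ω a) 0
        simp only [fc18, Nat.factorial_zero, Nat.cast_one, one_mul, pow_zero,
          PowerSeries.coeff_zero_eq_constantCoeff_apply] at h0
        rw [map_add, map_one, h0]
        simp only [twoUnit]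
        norm_num
      · intro n
        have : fc18 (PowerSeries.rescale (ω a) (PowerSeries.exp K) + 1) n
            = fc18 (PowerSeries.rescale (ω a) (PowerSeries.exp K)) n + fc18 1 n := by
          simp [fc18, mul_add]
        rw [this, hexp]
        refine (IsUltrametricDist.norm_add_le_max _ _).trans (max_le ?_ (good18_one hR n))
        rw [norm_pow]
        exact pow_le_pow_left₀ (norm_nonneg _) (hω a) n
  have hfin := good18_mul hR (PowerSeries.rescale 0 (PowerSeries.exp K)) _ (by
    intro n
    rw [hexp, norm_pow, norm_zero]
    exact pow_le_pow_left₀ le_rfl hR n) (hprod Finset.univ) n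
  refine le_trans (le_of_eq ?_) hfin
  unfold eulerHO fc18
  rw [PowerSeries.coeff_smul, smul_eq_mul, mul_left_comm, norm_mul, norm_pow, h2, one_pow, one_mul]

lemma pow18 {K : Type*} [NontriviallyNormedField K] [IsUltrametricDist K]
    (x y : K) (hx : x ≠ 0) (hxy : ‖y‖ = ‖x‖) (m : ℕ) :
    ‖(y⁻¹) ^ m - (x⁻¹) ^ m + m * (x⁻¹) ^ (m + 1) * (y - x)‖
      ≤ ‖y - x‖ ^ 2 * (‖x‖⁻¹) ^ (m + 2) := by
  have hy : y ≠ 0 := by rw [← norm_ne_zero_iff, hxy]; simpa using hx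
  induction m with
  | zero => simp; positivity
  | succ m ih =>
    have key : (y⁻¹) ^ (m+1) - (x⁻¹) ^ (m+1) + ((m+1 : ℕ) : K) * (x⁻¹) ^ (m + 1+1) * (y - x)
      = y⁻¹ * ((y⁻¹) ^ m - (x⁻¹) ^ m + m * (x⁻¹) ^ (m + 1) * (y - x))
        + ((m + 1 : ℕ) : K) * (y⁻¹ * (x⁻¹) ^ (m+2) * (y-x)^2) := by
      have e1 : y⁻¹ * y = 1 := inv_mul_cancel₀ hy
      have e2 : x⁻¹ * x = 1 := inv_mul_cancel₀ hx
      generalize y⁻¹ = u at *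
      generalize x⁻¹ = v at *
      push_cast
      have e3 : v - u = u * v * (y - x) := by linear_combination (-v) * e1 + u * e2
      have e4 : u * v ^ (m+2) * (y-x)^2 = v^(m+1) * (v - u) * (y - x) := by rw [e3]; ring
      have e5 : u * v ^ (m+1) * (y-x) = v^m * (v - u) := by rw [e3]; ring
      rw [e4]
      linear_combination e5
    rw [key]
    refine (IsUltrametricDist.norm_add_le_max _ _).trans (max_le ?_ ?_)
    · rw [norm_mul, norm_inv, hxy]
      calc _ ≤ ‖x‖⁻¹ * (‖y - x‖ ^ 2 * (‖x‖⁻¹) ^ (m + 2)) := by gcongr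
        _ = _ := by ring
    · rw [norm_mul]
      calc _ ≤ 1 * ‖y⁻¹ * (x⁻¹) ^ (m+2) * (y-x)^2‖ := by
            gcongr
            exact IsUltrametricDist.norm_natCast_le_one K _
        _ = _ := by
            simp only [norm_mul, norm_pow, norm_inv, hxy]; ring

lemma genBinom18 (k j : ℕ) (hk : 1 ≤ k) :
    genBinom k j * ((k + j : ℕ) : ℤ) = k * genBinom (k + 1) j := by
  obtain ⟨k, rfl⟩ := Nat.exists_eq_add_of_le' hk
  unfold genBinom
  have h := Nat.choose_mul_succ_eq (k + j) j
  rw [show k + j + 1 - j = k + 1 by omega] at h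
  rw [show k + 1 + j - 1 = k + j by omega, show k + 1 + 1 + j - 1 = k + j + 1 by omega,
    show k + 1 + j = k + j + 1 by omega]
  have h' : (((k+j).choose j : ℕ) : ℤ) * ((k + j + 1 : ℕ) : ℤ)
    = ((k+j+1).choose j : ℕ) * ((k + 1 : ℕ) : ℤ) := by exact_mod_cast h
  linear_combination (-1) ^ j * h'

lemma zpow18 {K : Type*} [NontriviallyNormedField K] (y : K) (k j : ℕ) :
    y ^ (-(k : ℤ) - (j : ℤ)) = (y⁻¹) ^ (k + j) := by
  rw [show (-(k : ℤ) - (j : ℤ)) = -((k + j : ℕ) : ℤ) by push_cast; ring, zpow_neg, zpow_natCast,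
    inv_pow]

lemma coef18 {K : Type*} [NontriviallyNormedField K] [IsUltrametricDist K] {R : ℝ}
    (E : ℕ → K) (hE : ∀ n, ‖E n‖ ≤ R ^ n) (k j : ℕ) :
    ‖(genBinom k j : K) * E j‖ ≤ R ^ j := by
  rw [norm_mul]
  calc _ ≤ 1 * ‖E j‖ := by
        gcongr
        exact IsUltrametricDist.norm_intCast_le_one K _
    _ ≤ _ := by rw [one_mul]; exact hE j

lemma summable18 {K : Type*} [NontriviallyNormedField K] [CompleteSpace K]
    [IsUltrametricDist K] {R : ℝ} (hR : 0 ≤ R)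
    (E : ℕ → K) (hE : ∀ n, ‖E n‖ ≤ R ^ n) (k : ℕ) (y : K) (hy : R < ‖y‖) :
    Summable (fun j : ℕ => (genBinom k j : K) * E j * y ^ (-(k : ℤ) - (j : ℤ))) := by
  have hy0 : 0 < ‖y‖ := hR.trans_lt hy
  have hg : Summable (fun j : ℕ => (‖y‖⁻¹) ^ k * (R * ‖y‖⁻¹) ^ j) := by
    refine (summable_geometric_of_lt_one (by positivity) ?_).mul_left _
    rw [← div_eq_mul_inv, div_lt_one hy0]; exact hy
  refine Summable.of_norm_bounded hg fun j => ?_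
  rw [norm_mul, zpow18, norm_pow, norm_inv]
  calc _ ≤ R ^ j * ‖y‖⁻¹ ^ (k + j) := by
        gcongr
        exact coef18 E hE k j
    _ = _ := by rw [mul_pow]; ring

theorem stmt18 (p : ℕ) [Fact p.Prime] (hp : p ≠ 2)
    (K : Type*) [NontriviallyNormedField K] [CompleteSpace K]
    [NormedAlgebra ℚ_[p] K] [IsUltrametricDist K] [CharZero K]
    (N k : ℕ) (hN : 1 ≤ N) (hk : 1 ≤ k) (ω : Fin N → K) :
    (∀ y : K, (∀ i, ‖ω i‖ < ‖y‖) →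
      Summable (fun j : ℕ =>
        (genBinom k j : K) * eulerHO K N ω 0 j * y ^ (-(k : ℤ) - (j : ℤ)))) ∧
    (∀ x : K, (∀ i, ‖ω i‖ < ‖x‖) →
      HasDerivAt (gfun K N ω k) (-(k : K) * gfun K N ω (k + 1) x) x) := by
  have h2 : ‖(2 : K)‖ = 1 := by
    have h : ‖((2 : ℕ) : ℚ_[p])‖ = 1 := by
      rw [Padic.norm_natCast_eq_one_iff]
      exact (Nat.coprime_primes Fact.out Nat.prime_two).mpr hp
    rw [← h, ← norm_algebraMap' K ((2 : ℕ) : ℚ_[p])]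
    rw [map_natCast]; norm_num
  have : Nonempty (Fin N) := ⟨⟨0, hN⟩⟩
  obtain ⟨i0, -, hi0⟩ := Finset.exists_max_image Finset.univ (fun i => ‖ω i‖) Finset.univ_nonempty
  have hR : 0 ≤ ‖ω i0‖ := norm_nonneg _
  have hE := euler18_bound hR h2 N ω (fun i => hi0 i (Finset.mem_univ _))
  refine ⟨fun y hy => summable18 hR _ hE k y (hy i0), fun x hx => ?_⟩
  have hx0 : 0 < ‖x‖ := hR.trans_lt (hx i0)
  have hxne : x ≠ 0 := norm_pos_iff.mp hx0
  rw [hasDerivAt_iff_isLittleO]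
  have hO : (fun y => gfun K N ω k y - gfun K N ω k x
      - (y - x) • (-(k : K) * gfun K N ω (k + 1) x)) =O[nhds x] fun y => ‖y - x‖ ^ 2 := by
    refine Asymptotics.IsBigO.of_bound ((‖x‖⁻¹) ^ (k + 2)) ?_
    filter_upwards [Metric.ball_mem_nhds x hx0] with y hy
    have hyx : ‖y‖ = ‖x‖ := by
      rw [Metric.mem_ball, dist_eq_norm] at hy
      have := IsUltrametricDist.norm_add_eq_max_of_norm_ne_norm (x := y - x) (y := x) hy.ne
      rw [sub_add_cancel] at this
      rw [this, max_eq_right hy.le]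
    have s1 := summable18 hR _ hE k y (hyx ▸ hx i0)
    have s2 := summable18 hR _ hE k x (hx i0)
    have s3 := summable18 hR _ hE (k + 1) x (hx i0)
    unfold gfun
    rw [smul_eq_mul, ← mul_assoc, ← tsum_mul_left, ← s1.tsum_sub s2,
      ← (s1.sub s2).tsum_sub (s3.mul_left _)]
    rw [Real.norm_of_nonneg (by positivity : (0:ℝ) ≤ ‖y - x‖ ^ 2)]
    refine IsUltrametricDist.norm_tsum_le_of_forall_le_of_nonneg (by positivity) fun j => ?_
    have hb : (genBinom k j : K) * ((k + j : ℕ) : K) = k * (genBinom (k + 1) j : K) := by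
      exact_mod_cast congrArg (Int.cast : ℤ → K) (genBinom18 k j hk)
    have e : (genBinom k j : K) * eulerHO K N ω 0 j * y ^ (-(k : ℤ) - (j : ℤ))
        - (genBinom k j : K) * eulerHO K N ω 0 j * x ^ (-(k : ℤ) - (j : ℤ))
        - (y - x) * -(k : K) * ((genBinom (k + 1) j : K) * eulerHO K N ω 0 j *
            x ^ (-((k + 1 : ℕ) : ℤ) - (j : ℤ)))
        = (genBinom k j : K) * eulerHO K N ω 0 j * ((y⁻¹) ^ (k + j) - (x⁻¹) ^ (k + j)
          + ((k + j : ℕ) : K) * (x⁻¹) ^ (k + j + 1) * (y - x)) := by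
      rw [zpow18, zpow18, zpow18, show k + 1 + j = k + j + 1 by omega]
      linear_combination (-(y - x) * eulerHO K N ω 0 j * (x⁻¹) ^ (k + j + 1)) * hb
    rw [e, norm_mul]
    have hlt : ‖ω i0‖ * ‖x‖⁻¹ ≤ 1 := by
      rw [← div_eq_mul_inv, div_le_one hx0]; exact (hx i0).le
    calc _ ≤ ‖ω i0‖ ^ j * (‖y - x‖ ^ 2 * (‖x‖⁻¹) ^ (k + j + 2)) := by
          gcongr
          · exact coef18 _ hE k j
          · exact pow18 x y hxne hyx _
      _ = (‖ω i0‖ * ‖x‖⁻¹) ^ j * (‖x‖⁻¹ ^ (k + 2) * ‖y - x‖ ^ 2) := by rw [mul_pow]; ring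
      _ ≤ 1 * (‖x‖⁻¹ ^ (k + 2) * ‖y - x‖ ^ 2) := by
          gcongr
          exact pow_le_one₀ (by positivity) hlt
      _ = _ := one_mul _
  refine hO.trans_isLittleO ?_
  have := Asymptotics.isLittleO_pow_sub_sub x (one_lt_two)
  exact this
end

section
/- Let p be an odd prime and K as below. Let N ≥ 1, let x, ω₁,…,ω_N ∈ K, and let j ∈ ℕ. Then ‖E_{N,j}(x; ω₁,…,ω_N)‖ ≤ (max(‖x‖, ‖ω₁‖, …, ‖ω_N‖))^j. In particular ‖E_{N,j}(0;ω̄)‖ ≤ (max_{1≤i≤N} ‖ω_i‖)^j. -/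
open Finset in
theorem aux_mul {K : Type*} [NontriviallyNormedField K] [IsUltrametricDist K]
    (M : ℝ) (hM : 0 ≤ M) (a b : ℕ → K) (n : ℕ) (q : ℕ × ℕ → Prop) [DecidablePred q]
    (ha : ∀ k, ‖(k.factorial : K) * a k‖ ≤ M ^ k)
    (hb : ∀ k l, k + l = n → q (k, l) → ‖(l.factorial : K) * b l‖ ≤ M ^ l) :
    ‖(n.factorial : K) * ∑ x ∈ antidiagonal n, (if q x then a x.1 * b x.2 else 0)‖ ≤ M ^ n := by
  rw [Finset.mul_sum]
  refine IsUltrametricDist.norm_sum_le_of_forall_le_of_nonneg (by positivity) ?_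
  rintro ⟨k, l⟩ h
  have h' : k + l = n := by simpa using h
  split_ifs with hq
  · subst h'
    have e : (((k + l).factorial : K)) * (a k * b l) =
        ((k + l).choose k : K) * ((k.factorial * a k) * (l.factorial * b l)) := by
      rw [← Nat.add_choose_mul_factorial_mul_factorial k l]
      push_cast
      rw [Nat.choose_symm_add]
      ring
    simp only
    rw [e, norm_mul, norm_mul, pow_add]
    have h1 := IsUltrametricDist.norm_natCast_le_one K ((k + l).choose k)
    calc _ ≤ 1 * (M ^ k * M ^ l) := by
          gcongr
          · exact ha k
          · exact hb k l rfl hq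
      _ = _ := one_mul _
  · simp only [mul_zero, norm_zero]
    positivity

def PB {K : Type*} [NontriviallyNormedField K] (M : ℝ) (f : PowerSeries K) : Prop :=
  ∀ n, ‖(n.factorial : K) * PowerSeries.coeff n f‖ ≤ M ^ n

theorem PB.mul {K : Type*} [NontriviallyNormedField K] [IsUltrametricDist K]
    {M : ℝ} (hM : 0 ≤ M) {f g : PowerSeries K} (hf : PB M f) (hg : PB M g) : PB M (f * g) := by
  intro n
  have := aux_mul M hM (fun k => PowerSeries.coeff k f) (fun k => PowerSeries.coeff k g) n
    (fun _ => True) hf (fun k l _ _ => hg l)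
  simpa [PowerSeries.coeff_mul] using this

theorem PB.one {K : Type*} [NontriviallyNormedField K]
    {M : ℝ} (hM : 0 ≤ M) : PB M (1 : PowerSeries K) := by
  intro n
  rcases n with _ | n
  · simp
  · simp [PowerSeries.coeff_one]
    positivity

theorem PB.add {K : Type*} [NontriviallyNormedField K] [IsUltrametricDist K]
    {M : ℝ} {f g : PowerSeries K} (hf : PB M f) (hg : PB M g) : PB M (f + g) := by
  intro n
  rw [map_add, mul_add]
  exact (IsUltrametricDist.norm_add_le_max _ _).trans (max_le (hf n) (hg n))

theorem PB.exp {K : Type*} [NontriviallyNormedField K] [CharZero K]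
    {M : ℝ} {w : K} (hw : ‖w‖ ≤ M) : PB M (PowerSeries.rescale w (PowerSeries.exp K)) := by
  intro n
  have : (n.factorial : K) ≠ 0 := by exact_mod_cast n.factorial_ne_zero
  have e : (n.factorial : K) * PowerSeries.coeff n (PowerSeries.rescale w (PowerSeries.exp K))
      = w ^ n := by
    rw [PowerSeries.coeff_rescale, PowerSeries.coeff_exp]
    simp
    field_simp
  rw [e, norm_pow]
  gcongr

theorem PB.inv {K : Type*} [NontriviallyNormedField K] [IsUltrametricDist K]
    {M : ℝ} (hM : 0 ≤ M) {f : PowerSeries K} (hf : PB M f) (u : Kˣ) (hu : ‖(u : K)‖ = 1) :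
    PB M (PowerSeries.invOfUnit f u) := by
  have hu' : ‖((u⁻¹ : Kˣ) : K)‖ = 1 := by simp [hu]
  intro n
  induction n using Nat.strong_induction_on with
  | _ n ih =>
    rw [PowerSeries.coeff_invOfUnit]
    split_ifs with h
    · subst h
      simp [hu]
    · rw [mul_left_comm, norm_mul, norm_neg, hu', one_mul]
      exact aux_mul M hM (fun k => PowerSeries.coeff k f)
        (fun k => PowerSeries.coeff k (PowerSeries.invOfUnit f u)) n
        (fun x => x.2 < n) hf (fun k l _ hl => ih l hl)

theorem main_aux (p : ℕ) [Fact p.Prime] (hp : p ≠ 2)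
    (K : Type*) [NontriviallyNormedField K]
    [NormedAlgebra ℚ_[p] K] [IsUltrametricDist K] [CharZero K]
    (N : ℕ) (ω : Fin N → K) (x : K) (j : ℕ) (M : ℝ) (hx : ‖x‖ ≤ M) (hω : ∀ i, ‖ω i‖ ≤ M) :
    ‖eulerHO K N ω x j‖ ≤ M ^ j := by
  have hM : 0 ≤ M := (norm_nonneg x).trans hx
  have h2 : ‖(2 : K)‖ = 1 := by
    rw [show (2 : K) = algebraMap ℚ_[p] K ((2 : ℕ) : ℚ_[p]) by rw [map_natCast]; norm_num, norm_algebraMap']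
    rw [Padic.norm_natCast_eq_one_iff]
    exact (Nat.coprime_primes Fact.out Nat.prime_two).2 hp
  unfold eulerHO
  rw [PowerSeries.coeff_smul, smul_eq_mul, mul_left_comm, norm_mul, norm_pow, h2, one_pow, one_mul]
  refine PB.mul hM (PB.exp hx) ?_ j
  refine Finset.prod_induction _ (PB M) (fun _ _ => PB.mul hM) (PB.one hM) ?_
  intro i _
  exact PB.inv hM (PB.add (PB.exp (hω i)) (PB.one hM)) _ h2

/-- Let `p` be an odd prime and `K` a complete nontrivially normed
ultrametric field which is a normed `ℚ_[p]`-algebra. For `N ≥ 1`, `x, ω₁,…,ω_N ∈ K` and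
`j ∈ ℕ`, `‖E_{N,j}(x; ω₁,…,ω_N)‖ ≤ (max(‖x‖, ‖ω₁‖, …, ‖ω_N‖))^j`; in particular
`‖E_{N,j}(0;ω̄)‖ ≤ (maxᵢ ‖ωᵢ‖)^j`. -/
theorem stmt19 (p : ℕ) [Fact p.Prime] (hp : p ≠ 2)
    (K : Type*) [NontriviallyNormedField K] [CompleteSpace K]
    [NormedAlgebra ℚ_[p] K] [IsUltrametricDist K] [CharZero K]
    (N : ℕ) (hN : 1 ≤ N) (ω : Fin N → K) (x : K) (j : ℕ) :
    ‖eulerHO K N ω x j‖ ≤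
      (max ‖x‖ (Finset.univ.sup' (Finset.univ_nonempty_iff.mpr ⟨⟨0, hN⟩⟩)
        fun i => ‖ω i‖)) ^ j ∧
    ‖eulerHO K N ω 0 j‖ ≤
      (Finset.univ.sup' (Finset.univ_nonempty_iff.mpr ⟨⟨0, hN⟩⟩) fun i => ‖ω i‖) ^ j := by
  have hs : ∀ i, ‖ω i‖ ≤ Finset.univ.sup' (Finset.univ_nonempty_iff.mpr ⟨⟨0, hN⟩⟩)
      fun i => ‖ω i‖ := fun i => Finset.le_sup' (fun i => ‖ω i‖) (Finset.mem_univ i)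
  refine ⟨main_aux p hp K N ω x j _ (le_max_left _ _) fun i => (hs i).trans (le_max_right _ _),
    main_aux p hp K N ω 0 j _ ?_ hs⟩
  rw [norm_zero]
  exact (norm_nonneg _).trans (hs ⟨0, hN⟩)
end
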